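/- Let q be a prime power, c ≥ 1, and (V_0, ψ_0) a non-degenerate symplectic F_q-space of dimension 2c. Suppose V_0 carries an action of a cyclic group of order q^c + 1 inside Sp(V_0). Then the F_q-subalgebra E of End(V_0) generated by a generator η of this cyclic group is a field isomorphic to F_{q^{2c}}, the symplectic adjoint involution † restricts to an order-2 automorphism of E, and the cyclic group equals the norm-one subgroup E^1 = {a ∈ E^× : a·a^† = 1}. -/

import Mathlib

section
open Polynomial

theorem arith_key (q c m n : ℕ) (hm : 1 ≤ m) (hq : 2 ≤ q)
    (h1 : n ∣ q ^ m - 1) (h2 : n ∣ q ^ c + 1) (v c' : ℕ) (hcv : c = 2 ^ v * c') (hc' : Odd c') :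
    n ∣ 2 ∨ ∃ g, 2 * g ≤ m ∧ n ∣ q ^ g + 1 ∧ (q ^ (2 ^ v) + 1) ∣ q ^ g + 1 := by
  have e1 : (q : ZMod n) ^ m = 1 := by
    have := (ZMod.natCast_eq_zero_iff _ _).2 h1
    rw [Nat.cast_sub (Nat.one_le_pow _ _ (by omega))] at this
    push_cast at this
    exact sub_eq_zero.1 this
  have e2 : (q : ZMod n) ^ c = -1 := by
    have := (ZMod.natCast_eq_zero_iff _ _).2 h2
    push_cast at this
    exact eq_neg_of_add_eq_zero_left this
  obtain ⟨w, m', hm', rfl⟩ := Nat.exists_eq_two_pow_mul_odd (n := m) (by omega)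
  by_cases hw : w ≤ v
  · left
    rw [← ZMod.natCast_eq_zero_iff]
    have a1 : (q : ZMod n) ^ (c * m') = -1 := by rw [pow_mul, e2, hm'.neg_one_pow]
    have a2 : (q : ZMod n) ^ (c * m') = 1 := by
      obtain ⟨d, rfl⟩ := Nat.exists_eq_add_of_le hw
      have : c * m' = (2 ^ w * m') * (2 ^ d * c') := by rw [hcv, pow_add]; ring
      rw [this, pow_mul, e1, one_pow]
    rw [a1] at a2
    push_cast
    calc (2 : ZMod n) = 1 - (-1) := by ring
      _ = 0 := by rw [a2]; ring
  · right
    obtain ⟨d, rfl⟩ := Nat.exists_eq_add_of_le (show v + 1 ≤ w by omega)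
    set h := 2 ^ d * m' with hh
    have hmm : 2 ^ (v + 1 + d) * m' = 2 * (2 ^ v * h) := by rw [hh]; ring
    have hhpos : 0 < h := by have := hm'.pos; positivity
    set k := Nat.gcd c' h with hk
    have hko : Odd k := hc'.of_dvd_nat (Nat.gcd_dvd_left _ _)
    refine ⟨2 ^ v * k, ?_, ?_, ?_⟩
    · rw [hmm]
      have := Nat.le_of_dvd hhpos (Nat.gcd_dvd_right c' h)
      gcongr
    · have o1 : orderOf (q : ZMod n) ∣ 2 * (2 ^ v * h) := by
        rw [← hmm]; exact orderOf_dvd_of_pow_eq_one e1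
      have o2 : orderOf (q : ZMod n) ∣ 2 * (2 ^ v * c') := by
        apply orderOf_dvd_of_pow_eq_one
        rw [← hcv, mul_comm, pow_mul, e2]; ring
      have o3 := Nat.dvd_gcd o2 o1
      rw [Nat.gcd_mul_left, Nat.gcd_mul_left] at o3
      have o4 : (q : ZMod n) ^ (2 * (2 ^ v * k)) = 1 := orderOf_dvd_iff_pow_eq_one.1 o3
      obtain ⟨t, ht⟩ := Nat.gcd_dvd_left c' h
      rw [← hk] at ht
      have hto : Odd t := hc'.of_dvd_nat ⟨k, by rw [ht]; ring⟩
      obtain ⟨s, hs⟩ := hto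
      have : c = 2 * (2 ^ v * k) * s + 2 ^ v * k := by rw [hcv, ht, hs]; ring
      rw [this, pow_add, pow_mul, o4, one_pow, one_mul] at e2
      rw [← ZMod.natCast_eq_zero_iff]
      push_cast
      rw [e2]; ring
    · rw [pow_mul]
      simpa using hko.nat_add_dvd_pow_add_pow (q ^ (2 ^ v)) 1

theorem poly_key (F : Type*) [Field F] [Fintype F] (q c : ℕ) (hF : Fintype.card F = q)
    (hc : 1 ≤ c) (μ : F[X]) (hdvd : μ ∣ X ^ (q ^ c + 1) - 1)
    (hmin : ∀ L, μ ∣ X ^ L - 1 → q ^ c + 1 ∣ L) (hdeg : μ.natDegree ≤ 2 * c) :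
    Irreducible μ ∧ μ.natDegree = 2 * c := by
  classical
  have hq : 2 ≤ q := by rw [← hF]; exact Fintype.one_lt_card
  obtain ⟨v, c', hc', hcv⟩ := Nat.exists_eq_two_pow_mul_odd (n := c) (by omega)
  have hqF : (q : F) = 0 := by rw [← hF]; simp
  have hsep : (X ^ (q ^ c + 1) - 1 : F[X]).Separable := by
    rw [X_pow_sub_one_separable_iff]
    push_cast
    rw [hqF, zero_pow (by omega)]; simp
  have hsq : Squarefree μ := (hsep.of_dvd hdvd).squarefree
  have hμ0 : μ ≠ 0 := hsq.ne_zero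
  have htype : ∀ f : F[X], Irreducible f → f ∣ μ →
      f ∣ X ^ 2 - 1 ∨ ∃ g, 2 * g ≤ f.natDegree ∧ f ∣ X ^ (q ^ g + 1) - 1 ∧
        (q ^ (2 ^ v) + 1) ∣ q ^ g + 1 := by
    intro f hf hfμ
    have : Fact (Irreducible f) := ⟨hf⟩
    have hiff : ∀ L, f ∣ X ^ L - 1 ↔ orderOf (AdjoinRoot.root f) ∣ L := by
      intro L
      rw [orderOf_dvd_iff_pow_eq_one, ← AdjoinRoot.mk_eq_zero]
      simp [sub_eq_zero]
    have h2 := (hiff _).1 (hfμ.trans hdvd)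
    have h1 : orderOf (AdjoinRoot.root f) ∣ q ^ f.natDegree - 1 := by
      have : Module.Finite F (AdjoinRoot f) := (AdjoinRoot.powerBasis hf.ne_zero).finite
      have : Finite (AdjoinRoot f) := Module.finite_of_finite F
      have := Fintype.ofFinite (AdjoinRoot f)
      have hcard : Fintype.card (AdjoinRoot f) = q ^ f.natDegree := by
        rw [← Nat.card_eq_fintype_card, Module.natCard_eq_pow_finrank (K := F),
          Nat.card_eq_fintype_card, hF, (AdjoinRoot.powerBasis hf.ne_zero).finrank,
          AdjoinRoot.powerBasis_dim]
      rw [← hcard]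
      apply orderOf_dvd_of_pow_eq_one
      apply FiniteField.pow_card_sub_one_eq_one
      intro h0
      have : (AdjoinRoot.root f) ^ (q ^ c + 1) = 1 := orderOf_dvd_iff_pow_eq_one.1 h2
      rw [h0, zero_pow (by omega)] at this
      exact zero_ne_one this
    simp only [hiff]
    exact arith_key q c _ _ hf.natDegree_pos hq h1 h2 v c' hcv hc'
  set S := (UniqueFactorizationMonoid.normalizedFactors μ).toFinset with hS
  have hnodup := (UniqueFactorizationMonoid.squarefree_iff_nodup_normalizedFactors hμ0).1 hsq
  have hassoc : Associated (∏ f ∈ S, f) μ := by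
    have := UniqueFactorizationMonoid.prod_normalizedFactors hμ0
    rwa [hS, Finset.prod, Multiset.toFinset_val, hnodup.dedup, Multiset.map_id']
  have hirr : ∀ f ∈ S, Irreducible f := fun f hf =>
    UniqueFactorizationMonoid.irreducible_of_normalized_factor f (Multiset.mem_toFinset.1 hf)
  have hSd : ∀ f ∈ S, f ∣ μ := fun f hf =>
    UniqueFactorizationMonoid.dvd_of_mem_normalizedFactors (Multiset.mem_toFinset.1 hf)
  have hnorm : ∀ f ∈ S, normalize f = f := fun f hf =>
    UniqueFactorizationMonoid.normalize_normalized_factor f (Multiset.mem_toFinset.1 hf)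
  have hall : ∀ p : F[X], (∀ f ∈ S, f ∣ p) → μ ∣ p := by
    intro p hp
    refine hassoc.symm.dvd.trans (Finset.prod_dvd_of_coprime ?_ hp)
    intro f hf g hg hfg
    refine (hirr f hf).coprime_iff_not_dvd.2 ?_
    intro hd
    apply hfg
    have := (hirr f hf).associated_of_dvd (hirr g hg) hd
    rw [← hnorm f hf, ← hnorm g hg]
    exact normalize_eq_normalize_iff_associated.2 this
  have hdegS : ∑ f ∈ S, f.natDegree = μ.natDegree := by
    rw [← natDegree_eq_of_degree_eq (degree_eq_degree_of_associated hassoc),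
      natDegree_prod _ _ (fun f hf => (hirr f hf).ne_zero)]
  have htype' : ∀ f ∈ S, f ∣ X ^ 2 - 1 ∨ ∃ g, 2 * g ≤ f.natDegree ∧ f ∣ X ^ (q ^ g + 1) - 1 ∧
        (q ^ (2 ^ v) + 1) ∣ q ^ g + 1 := fun f hf => htype f (hirr f hf) (hSd f hf)
  set T := S.filter (fun f => ¬ f ∣ X ^ 2 - 1) with hT
  have hTS : T ⊆ S := Finset.filter_subset _ _
  have hex : ∀ f : F[X], ∃ g b, f ∈ T → 2 * g ≤ f.natDegree ∧ f ∣ X ^ (q ^ g + 1) - 1 ∧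
      q ^ g + 1 = (q ^ (2 ^ v) + 1) * b := by
    intro f
    by_cases hf : f ∈ T
    · obtain ⟨hf1, hf2⟩ := Finset.mem_filter.1 hf
      obtain ⟨g, a, b, ⟨d, hd⟩⟩ := (htype' f hf1).resolve_left hf2
      exact ⟨g, d, fun _ => ⟨a, b, hd⟩⟩
    · exact ⟨0, 0, fun h => absurd h hf⟩
  choose g b hgb using hex
  set M := q ^ (2 ^ v) + 1 with hM
  have hq0 : 1 ≤ q ^ c := Nat.one_le_pow _ _ (by omega)
  have hqc : 2 ≤ q ^ c := hq.trans (Nat.le_self_pow (by omega) q)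
  have hpd : ∀ a b : ℕ, a ∣ b → (X ^ a - 1 : F[X]) ∣ X ^ b - 1 := by
    rintro a _ ⟨k, rfl⟩
    rw [pow_mul]
    simpa using sub_dvd_pow_sub_pow (X ^ a : F[X]) 1 k
  have hTne : T.Nonempty := by
    by_contra hne
    rw [Finset.not_nonempty_iff_eq_empty] at hne
    have : μ ∣ X ^ 2 - 1 := hall _ (fun f hf => by
      by_contra h
      have : f ∈ T := Finset.mem_filter.2 ⟨hf, h⟩
      simp [hne] at this)
    have := Nat.le_of_dvd (by norm_num) (hmin _ this)
    omega
  have hTI : ∀ f ∈ S, f ∉ T → f ∣ X ^ M - 1 := by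
    intro f hf hfT
    have h2 : f ∣ X ^ 2 - 1 := by
      by_contra h
      exact hfT (Finset.mem_filter.2 ⟨hf, h⟩)
    rcases Nat.even_or_odd q with he | ho
    · have hgcd : Nat.gcd 2 (q ^ c + 1) = 1 := by
        have : Odd (q ^ c + 1) := (he.pow_of_ne_zero (by omega)).add_one
        exact (Nat.coprime_two_left).2 this
      have hN := (hSd f hf).trans hdvd
      have h1 : f ∣ X ^ 1 - 1 := by
        rw [← hgcd]
        rw [← AdjoinRoot.mk_eq_zero] at h2 hN ⊢
        simp only [map_sub, map_pow, map_one, sub_eq_zero] at h2 hN ⊢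
        exact orderOf_dvd_iff_pow_eq_one.1 (Nat.dvd_gcd (orderOf_dvd_of_pow_eq_one h2)
          (orderOf_dvd_of_pow_eq_one hN))
      exact h1.trans (hpd _ _ (one_dvd _))
    · have : Even M := (ho.pow).add_one
      exact h2.trans (hpd _ _ this.two_dvd)
  have hL : q ^ c + 1 ∣ M * ∏ f ∈ T, b f := by
    apply hmin
    apply hall
    intro f hf
    by_cases hfT : f ∈ T
    · refine (hgb f hfT).2.1.trans (hpd _ _ ?_)
      rw [(hgb f hfT).2.2]
      exact mul_dvd_mul_left _ (Finset.dvd_prod_of_mem _ hfT)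
    · exact (hTI f hf hfT).trans (hpd _ _ (dvd_mul_right _ _))
  have hbpos : ∀ f ∈ T, 0 < b f := by
    intro f hf
    have := (hgb f hf).2.2
    by_contra h0
    have h1 : b f = 0 := by omega
    rw [h1] at this
    omega
  have hLle := Nat.le_of_dvd (Nat.mul_pos (by omega) (Finset.prod_pos hbpos)) hL
  have hbb : ∀ f ∈ T, b f * q ^ (2 ^ v) ≤ q ^ (g f) := by
    intro f hf
    have h1 := (hgb f hf).2.2
    have h2 := hbpos f hf
    rw [hM] at h1
    nlinarith
  have hprod : (∏ f ∈ T, b f) * (q ^ (2 ^ v)) ^ T.card ≤ q ^ c := by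
    calc (∏ f ∈ T, b f) * (q ^ (2 ^ v)) ^ T.card = ∏ f ∈ T, (b f * q ^ (2 ^ v)) := by
          rw [Finset.prod_mul_distrib, Finset.prod_const]
      _ ≤ ∏ f ∈ T, q ^ (g f) := Finset.prod_le_prod' hbb
      _ = q ^ (∑ f ∈ T, g f) := by rw [Finset.prod_pow_eq_pow_sum]
      _ ≤ q ^ c := by
          apply Nat.pow_le_pow_right (by omega)
          have h1 : ∑ f ∈ T, 2 * g f ≤ ∑ f ∈ T, f.natDegree :=
            Finset.sum_le_sum fun f hf => (hgb f hf).1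
          have h2 : ∑ f ∈ T, f.natDegree ≤ ∑ f ∈ S, f.natDegree :=
            Finset.sum_le_sum_of_subset hTS
          rw [← Finset.mul_sum] at h1
          omega
  have hQ : 2 ≤ q ^ (2 ^ v) := hq.trans (Nat.le_self_pow (by positivity) q)
  have hcard : T.card = 1 := by
    have h1 := hTne.card_pos
    by_contra hne
    have h2 : (q ^ (2 ^ v)) ^ 2 ≤ (q ^ (2 ^ v)) ^ T.card :=
      Nat.pow_le_pow_right (by omega) (by omega)
    have h3 : M ≤ (q ^ (2 ^ v)) ^ 2 := by rw [hM]; nlinarith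
    have h4 := Nat.mul_le_mul_left (∏ f ∈ T, b f) (h3.trans h2)
    rw [mul_comm M] at hLle
    omega
  obtain ⟨f, hf⟩ := Finset.card_eq_one.1 hcard
  have hfT : f ∈ T := by simp [hf]
  rw [hf, Finset.prod_singleton, ← (hgb f hfT).2.2] at hLle
  have hcg : c ≤ g f := (Nat.pow_le_pow_iff_right (by omega)).1 (by omega : q ^ c ≤ q ^ (g f))
  have hd1 := (hgb f hfT).1
  have hfμ := hSd f (hTS hfT)
  have hd2 := natDegree_le_of_dvd hfμ hμ0
  have hA : Associated f μ := by
    obtain ⟨r, hr⟩ := hfμ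
    have hr0 : r ≠ 0 := by rintro rfl; simp_all
    have hf0 := (hirr f (hTS hfT)).ne_zero
    have : μ.natDegree = f.natDegree + r.natDegree := by rw [hr, natDegree_mul hf0 hr0]
    have hru : IsUnit r := by
      rw [Polynomial.isUnit_iff_degree_eq_zero, degree_eq_natDegree hr0]
      have : r.natDegree = 0 := by omega
      simp [this]
    exact ⟨hru.unit, by simp [hr]⟩
  exact ⟨hA.irreducible (hirr f (hTS hfT)), by omega⟩

end

theorem adjoin_isField {F A : Type*} [Field F] [Ring A] [Algebra F A] (e : A)
    (hirr : Irreducible (minpoly F e)) : IsField (Algebra.adjoin F {e}) := by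
  have hnt : Nontrivial A := by
    by_contra h
    rw [not_nontrivial_iff_subsingleton] at h
    apply hirr.not_isUnit
    rw [minpoly.subsingleton]
    exact isUnit_one
  have hrep : ∀ a ∈ Algebra.adjoin F {e}, ∃ p : Polynomial F, Polynomial.aeval e p = a := by
    intro a ha
    rw [Algebra.adjoin_singleton_eq_range_aeval] at ha
    exact ha
  refine ⟨⟨0, 1, zero_ne_one⟩, ?_, ?_⟩
  · rintro ⟨a, ha⟩ ⟨b, hb⟩
    obtain ⟨p, rfl⟩ := hrep a ha
    obtain ⟨r, rfl⟩ := hrep b hb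
    apply Subtype.ext
    change Polynomial.aeval e p * Polynomial.aeval e r = Polynomial.aeval e r * Polynomial.aeval e p
    rw [← map_mul, ← map_mul, mul_comm]
  · rintro ⟨a, ha⟩ ha0
    obtain ⟨p, rfl⟩ := hrep a ha
    have hnd : ¬ minpoly F e ∣ p := by
      intro h
      apply ha0
      exact Subtype.ext ((minpoly.dvd_iff).1 h)
    obtain ⟨x, y, hxy⟩ := hirr.coprime_iff_not_dvd.2 hnd
    refine ⟨⟨Polynomial.aeval e y, ?_⟩, ?_⟩
    · rw [Algebra.adjoin_singleton_eq_range_aeval]; exact ⟨y, rfl⟩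
    · apply Subtype.ext
      change Polynomial.aeval e p * Polynomial.aeval e y = 1
      have := congrArg (Polynomial.aeval e) hxy
      rw [map_add, map_mul, map_mul, minpoly.aeval, mul_zero, zero_add, map_one, ← map_mul,
        mul_comm, map_mul] at this
      exact this

theorem adjoin_natCard {F A : Type*} [Field F] [Fintype F] [Ring A] [Algebra F A]
    [Module.Finite F A] (e : A) :
    Nat.card (Algebra.adjoin F {e}) = Fintype.card F ^ (minpoly F e).natDegree := by
  have : Module.Finite F (Algebra.adjoin F {e}) := Module.Finite.of_injective
    (Algebra.adjoin F {e}).val.toLinearMap Subtype.val_injective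
  rw [Module.natCard_eq_pow_finrank (K := F), Nat.card_eq_fintype_card]
  congr 1
  rw [Algebra.adjoin_singleton_eq_range_aeval,
    ← (Ideal.quotientKerEquivRange (Polynomial.aeval (R := F) e)).toLinearEquiv.finrank_eq,
    ← finrank_quotient_span_eq_natDegree]
  exact ((Ideal.quotientEquivAlgOfEq F
    (minpoly.ker_aeval_eq_span_minpoly F e)).toLinearEquiv.finrank_eq)


/-- Let `q` be a prime power, `c ≥ 1`, and `(V₀, ψ₀)` a non-degenerate symplectic `F_q`-space
of dimension `2c` carrying a cyclic group of order `q^c + 1` inside `Sp(V₀)`, generated by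
`η`.  Then the `F_q`-subalgebra `E` of `End(V₀)` generated by `η` is a field isomorphic to
`F_{q^{2c}}` (a field of cardinality `q^{2c}`), the symplectic adjoint involution `†` restricts
to an automorphism of `E` of order `2`, and the cyclic group equals the norm-one subgroup
`E¹ = {a ∈ E^× : a·a† = 1}`. -/
theorem cyclic_symplectic_subfield
    (q c : ℕ) (hq : IsPrimePow q) (hc : 1 ≤ c)
    (F : Type*) [Field F] [Fintype F] (hF : Fintype.card F = q)
    (V : Type*) [AddCommGroup V] [Module F V] [FiniteDimensional F V]
    (hdim : Module.finrank F V = 2 * c)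
    (ψ : V →ₗ[F] V →ₗ[F] F)
    (halt : ∀ v : V, ψ v v = 0)
    (hnondeg : ∀ v : V, (∀ w : V, ψ v w = 0) → v = 0)
    -- the symplectic adjoint involution `†` on `End(V₀)`
    (dag : Module.End F V → Module.End F V)
    (hdag_add : ∀ A B₁ : Module.End F V, dag (A + B₁) = dag A + dag B₁)
    (hdag_mul : ∀ A B₁ : Module.End F V, dag (A * B₁) = dag B₁ * dag A)
    (hdag_inv : ∀ A : Module.End F V, dag (dag A) = A)
    (hdag_adj : ∀ (A : Module.End F V) (v w : V), ψ (A v) w = ψ v (dag A w))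
    -- the cyclic group of order `q^c + 1` inside `Sp(V₀)`, generated by `η`
    (η : (Module.End F V)ˣ)
    (hη_sp : ∀ v w : V, ψ ((η : Module.End F V) v) ((η : Module.End F V) w) = ψ v w)
    (hη_ord : orderOf η = q ^ c + 1) :
    IsField (Algebra.adjoin F {(η : Module.End F V)}) ∧
    Nat.card (Algebra.adjoin F {(η : Module.End F V)}) = q ^ (2 * c) ∧
    (∀ A ∈ Algebra.adjoin F {(η : Module.End F V)},
      dag A ∈ Algebra.adjoin F {(η : Module.End F V)}) ∧
    (∃ A ∈ Algebra.adjoin F {(η : Module.End F V)}, dag A ≠ A) ∧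
    ∀ u : (Module.End F V)ˣ,
      ((u : Module.End F V) ∈ Algebra.adjoin F {(η : Module.End F V)} ∧
        (u : Module.End F V) * dag (u : Module.End F V) = 1) ↔
      u ∈ Subgroup.zpowers η := by
  have hq2 : 2 ≤ q := by rw [← hF]; exact Fintype.one_lt_card
  have hqc : 2 ≤ q ^ c := hq2.trans (Nat.le_self_pow (by omega) q)
  set e : Module.End F V := (η : Module.End F V) with he
  have hiff : ∀ L, minpoly F e ∣ Polynomial.X ^ L - 1 ↔ orderOf η ∣ L := by
    intro L
    rw [orderOf_dvd_iff_pow_eq_one, minpoly.dvd_iff]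
    simp only [map_sub, map_pow, Polynomial.aeval_X, map_one, sub_eq_zero]
    rw [Units.ext_iff]; simp [he]
  have hint : IsIntegral F e := Algebra.IsIntegral.isIntegral e
  have hdeg : (minpoly F e).natDegree ≤ 2 * c := by
    rw [← hdim, ← LinearMap.charpoly_natDegree e]
    exact Polynomial.natDegree_le_of_dvd (LinearMap.minpoly_dvd_charpoly e)
      (LinearMap.charpoly_monic e).ne_zero
  obtain ⟨hirr, hdeg2⟩ := poly_key F q c hF hc (minpoly F e)
    ((hiff _).2 (by rw [hη_ord])) (fun L hL => hη_ord ▸ (hiff L).1 hL) hdeg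
  have hfield := adjoin_isField e hirr
  have hpow : e ^ (q ^ c + 1) = 1 := by
    rw [he, ← Units.val_pow_eq_pow_val, ← hη_ord, pow_orderOf_eq_one, Units.val_one]
  have hskew : ∀ v w, ψ v w = - ψ w v := by
    intro v w
    have := halt (v + w)
    simp only [map_add, LinearMap.add_apply, halt, zero_add, add_zero] at this
    exact eq_neg_of_add_eq_zero_right this
  have hadj : ∀ A B : Module.End F V, (∀ v w, ψ (A v) w = ψ v (B w)) → dag A = B := by
    intro A B h
    ext w
    rw [← sub_eq_zero]
    apply hnondeg
    intro v
    rw [hskew, map_sub, ← hdag_adj, ← h, sub_self, neg_zero]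
  have hdagη : dag e = e ^ (q ^ c) := by
    apply hadj
    intro v w
    rw [← hη_sp v, ← Module.End.mul_apply, ← pow_succ', hpow, Module.End.one_apply]
  have hdagF : ∀ r : F, dag (algebraMap F (Module.End F V) r) = algebraMap F _ r := by
    intro r
    apply hadj
    intro v w
    simp [Module.algebraMap_end_apply]
  obtain ⟨p, k, hp, hk, hpk⟩ := (isPrimePow_nat_iff q).1 hq
  have : Fact p.Prime := ⟨hp⟩
  have hchar : CharP F p := by
    obtain ⟨p', hp'⟩ := CharP.exists F
    obtain ⟨n, hp1, hn⟩ := FiniteField.card F p'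
    have : p' = p := by
      rw [hF, ← hpk] at hn
      have h1 : p' ∣ p ^ k := hn ▸ dvd_pow_self p' n.ne_zero
      exact (Nat.prime_dvd_prime_iff_eq hp1 hp).1 (hp1.dvd_of_dvd_pow h1)
    exact this ▸ hp'
  have hnt : Nontrivial V := Module.nontrivial_of_finrank_pos (R := F) (by omega)
  have hcharE : CharP (Module.End F V) p :=
    charP_of_injective_algebraMap (algebraMap F (Module.End F V)).injective p
  have hdagE : ∀ A ∈ Algebra.adjoin F {e}, dag A = A ^ (q ^ c) := by
    intro A hA
    have hcomm : ∀ x y, x ∈ Algebra.adjoin F {e} → y ∈ Algebra.adjoin F {e} → x * y = y * x := by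
      intro x y hx hy
      exact congrArg Subtype.val (hfield.mul_comm ⟨x, hx⟩ ⟨y, hy⟩)
    induction hA using Algebra.adjoin_induction with
    | mem x hx => rw [Set.mem_singleton_iff.1 hx]; exact hdagη
    | algebraMap r =>
      rw [hdagF, ← map_pow, ← hF, FiniteField.pow_card_pow]
    | add x y hx hy h1 h2 =>
      rw [hdag_add, h1, h2, ← hpk, ← pow_mul, add_pow_char_pow_of_commute]
      exact hcomm x y hx hy
    | mul x y hx hy h1 h2 =>
      have hxy : Commute x y := hcomm x y hx hy
      rw [hdag_mul, h1, h2, hxy.mul_pow]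
      exact ((hxy.pow_pow _ _).eq).symm
  have heE : e ∈ Algebra.adjoin F {e} := Algebra.subset_adjoin rfl
  refine ⟨hfield, ?_, ?_, ⟨e, heE, ?_⟩, ?_⟩
  · rw [adjoin_natCard e, hdeg2, hF]
  · intro A hA
    rw [hdagE A hA]
    exact pow_mem hA _
  · intro h
    rw [hdagη] at h
    have h2 : e ^ 2 = 1 := by
      rw [pow_two]; nth_rewrite 1 [← h]; rw [← pow_succ, hpow]
    have h3 : η ^ 2 = 1 := Units.ext (by simpa [he] using h2)
    have := Nat.le_of_dvd (by norm_num) (orderOf_dvd_of_pow_eq_one h3)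
    omega
  · intro u
    constructor
    · rintro ⟨hu, hu1⟩
      rw [hdagE _ hu, ← pow_succ'] at hu1
      let _ : Field (Algebra.adjoin F {e}) := hfield.toField
      have hprim : IsPrimitiveRoot (⟨e, heE⟩ : Algebra.adjoin F {e}) (q ^ c + 1) := by
        refine ⟨Subtype.ext (by simpa using hpow), fun l hl => hη_ord ▸ orderOf_dvd_of_pow_eq_one ?_⟩
        apply Units.ext
        have := congrArg Subtype.val hl
        simpa using this
      obtain ⟨i, -, hi⟩ := hprim.eq_pow_of_pow_eq_one
        (ξ := (⟨u, hu⟩ : Algebra.adjoin F {e})) (Subtype.ext (by simpa using hu1))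
      have h2 : η ^ i = u := Units.ext (by
        have := congrArg Subtype.val hi
        simpa using this)
      rw [← h2]
      exact Subgroup.npow_mem_zpowers η i
    · intro hu
      have hfin : IsOfFinOrder η := orderOf_pos_iff.1 (by omega)
      obtain ⟨i, rfl⟩ := (hfin.mem_powers_iff_mem_zpowers.2 hu : u ∈ Submonoid.powers η)
      have hm : ((η ^ i : (Module.End F V)ˣ) : Module.End F V) ∈ Algebra.adjoin F {e} := by
        rw [Units.val_pow_eq_pow_val]; exact pow_mem heE i
      refine ⟨hm, ?_⟩
      rw [hdagE _ hm, ← pow_succ', Units.val_pow_eq_pow_val, ← pow_mul, mul_comm, pow_mul]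
      change (e ^ (q ^ c + 1)) ^ i = 1
      rw [hpow, one_pow]
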